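/- Let E be a complex Banach space having Rademacher type 2 with constant T ∈ (0,∞). Then there exists C = C(T) ∈ (0,∞) such that for every ε ∈ (0,1), every n ∈ ℕ and every function f : 𝒞_n → E, one has ‖f − E_{σ_n} f‖_{L_2(σ_n;E)}^2 ≤ (C/ε) ∑_{i=1}^n ‖∂_i f‖_{L_2(σ_n;E)}^2 / (1 + log^{1−ε}(‖∂_i f‖_{L_2(σ_n;E)} / ‖∂_i f‖_{L_1(σ_n;E)})), with the convention that the i-th summand is 0 when ∂_i f vanishes identically. -/

import Mathlib

open Finset MeasureTheory Real Filter

noncomputable section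

/-- The discrete hypercube `𝒞_n = {-1,1}^n`, encoded as `Fin n → Bool`. -/
abbrev Cube (n : ℕ) := Fin n → Bool

/-- The sign `±1` associated to a boolean coordinate. -/
def sgn' (b : Bool) : ℝ := if b then 1 else -1

/-- Flip the `i`-th coordinate of a point of the hypercube. -/
def flipC {n : ℕ} (i : Fin n) (x : Cube n) : Cube n := Function.update x i (!(x i))

variable {E : Type*} [NormedAddCommGroup E]

/-- Expectation `E_{σ_n} f` with respect to the uniform probability measure on the cube. -/
def cubeAvg {n : ℕ} [NormedSpace ℝ E] (f : Cube n → E) : E :=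
  (2 ^ n : ℝ)⁻¹ • ∑ x : Cube n, f x

/-- The discrete partial derivative `∂_i f (ε) = (f(ε) - f(ε with i-th coordinate flipped))/2`. -/
def dparC {n : ℕ} [NormedSpace ℝ E] (i : Fin n) (f : Cube n → E) : Cube n → E :=
  fun x => (2 : ℝ)⁻¹ • (f x - f (flipC i x))

/-- The `L_p(σ_n; E)` norm of a function on the hypercube. -/
def cubeLp {n : ℕ} (p : ℝ) (f : Cube n → E) : ℝ :=
  ((2 ^ n : ℝ)⁻¹ * ∑ x : Cube n, ‖f x‖ ^ p) ^ (1 / p)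

lemma sgn'_mul_self (b : Bool) : sgn' b * sgn' b = 1 := by cases b <;> simp [sgn']

lemma abs_sgn' (b : Bool) : |sgn' b| = 1 := by cases b <;> simp [sgn']

lemma sgn'_not (b : Bool) : sgn' (!b) = -sgn' b := by cases b <;> simp [sgn']

lemma flipC_flipC {n : ℕ} (i : Fin n) (x : Cube n) : flipC i (flipC i x) = x := by
  simp [flipC]

/-- Flipping one coordinate, as a permutation of the cube. -/
def flipEquiv {n : ℕ} (i : Fin n) : Equiv.Perm (Cube n) :=
  Function.Involutive.toPerm (flipC i) (flipC_flipC i)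

lemma sum_flipC {n : ℕ} {M : Type*} [AddCommMonoid M] (i : Fin n) (g : Cube n → M) :
    ∑ x, g (flipC i x) = ∑ x, g x :=
  Equiv.sum_comp (flipEquiv i) g

lemma sum_cube_prod {n : ℕ} (g : Fin n → Bool → ℝ) :
    ∑ x : Cube n, ∏ i, g i (x i) = ∏ i, (g i true + g i false) := by
  have := Finset.prod_univ_sum (fun _ : Fin n => (Finset.univ : Finset Bool)) g
  simp only [Fintype.sum_bool, Fintype.piFinset_univ] at this
  exact this.symm

/-- One factor of the noise kernel. -/
def noiseFactor (ρ : ℝ) (a b : Bool) : ℝ := (1 + ρ * (sgn' a * sgn' b)) / 2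

/-- The kernel of the noise operator with correlation `ρ`. -/
def noiseKernel {n : ℕ} (ρ : ℝ) (x y : Cube n) : ℝ := ∏ i, noiseFactor ρ (x i) (y i)

/-- The derivative in `ρ` of the noise kernel. -/
def noiseKernelDeriv {n : ℕ} (ρ : ℝ) (x y : Cube n) : ℝ :=
  ∑ i, (∏ j ∈ univ.erase i, noiseFactor ρ (x j) (y j)) * (sgn' (x i) * sgn' (y i) / 2)

/-- The noise operator with correlation `ρ` on the cube. -/
def noise {n : ℕ} [NormedSpace ℝ E] (ρ : ℝ) (f : Cube n → E) (x : Cube n) : E :=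
  ∑ y, noiseKernel ρ x y • f y

/-- The derivative in `ρ` of the noise operator. -/
def noiseDeriv {n : ℕ} [NormedSpace ℝ E] (ρ : ℝ) (f : Cube n → E) (x : Cube n) : E :=
  ∑ y, noiseKernelDeriv ρ x y • f y

lemma noiseFactor_comm (ρ : ℝ) (a b : Bool) : noiseFactor ρ a b = noiseFactor ρ b a := by
  simp [noiseFactor, mul_comm (sgn' a)]

lemma noiseFactor_nonneg {ρ : ℝ} (h0 : 0 ≤ ρ) (h1 : ρ ≤ 1) (a b : Bool) :
    0 ≤ noiseFactor ρ a b := by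
  cases a <;> cases b <;> simp [noiseFactor, sgn'] <;> linarith

lemma noiseKernel_comm {n : ℕ} (ρ : ℝ) (x y : Cube n) :
    noiseKernel ρ x y = noiseKernel ρ y x :=
  Finset.prod_congr rfl fun _ _ => noiseFactor_comm _ _ _

lemma noiseKernel_nonneg {n : ℕ} {ρ : ℝ} (h0 : 0 ≤ ρ) (h1 : ρ ≤ 1) (x y : Cube n) :
    0 ≤ noiseKernel ρ x y :=
  Finset.prod_nonneg fun _ _ => noiseFactor_nonneg h0 h1 _ _

lemma sum_noiseKernel {n : ℕ} (ρ : ℝ) (y : Cube n) : ∑ x, noiseKernel ρ x y = 1 := by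
  unfold noiseKernel
  rw [sum_cube_prod (fun i b => noiseFactor ρ b (y i))]
  refine Finset.prod_eq_one fun i _ => ?_
  cases y i <;> simp [noiseFactor, sgn'] <;> ring

lemma sum_noiseKernel_right {n : ℕ} (ρ : ℝ) (x : Cube n) : ∑ y, noiseKernel ρ x y = 1 := by
  simp_rw [noiseKernel_comm ρ x]; exact sum_noiseKernel ρ x

lemma sum_noiseKernel_mul_sgn' {n : ℕ} (ρ : ℝ) (y : Cube n) (i : Fin n) :
    ∑ x, noiseKernel ρ x y * sgn' (x i) = ρ * sgn' (y i) := by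
  have h : ∀ x : Cube n, noiseKernel ρ x y * sgn' (x i) =
      ∏ j, (noiseFactor ρ (x j) (y j) * if j = i then sgn' (x j) else 1) := by
    intro x
    rw [Finset.prod_mul_distrib, Finset.prod_ite_eq' univ i (fun j => sgn' (x j))]
    simp [noiseKernel]
  simp_rw [h]
  rw [sum_cube_prod (fun j b => noiseFactor ρ b (y j) * if j = i then sgn' b else 1),
    Finset.prod_eq_single i]
  · cases y i <;> simp [noiseFactor, sgn'] <;> ring
  · intro j _ hj
    cases y j <;> simp [noiseFactor, sgn', hj] <;> ring
  · simp

lemma noiseKernel_mul {n : ℕ} (σ τ : ℝ) (x z : Cube n) :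
    ∑ y, noiseKernel σ x y * noiseKernel τ y z = noiseKernel (σ * τ) x z := by
  unfold noiseKernel
  simp_rw [← Finset.prod_mul_distrib]
  rw [sum_cube_prod (fun i b => noiseFactor σ (x i) b * noiseFactor τ b (z i))]
  refine Finset.prod_congr rfl fun i _ => ?_
  cases x i <;> cases z i <;> simp [noiseFactor, sgn'] <;> ring

lemma noise_noise {n : ℕ} [NormedSpace ℝ E] (σ τ : ℝ) (f : Cube n → E) :
    noise σ (noise τ f) = noise (σ * τ) f := by
  funext x
  simp only [noise, Finset.smul_sum, smul_smul, ← noiseKernel_mul, Finset.sum_smul]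
  exact Finset.sum_comm

lemma noise_one {n : ℕ} [NormedSpace ℝ E] (f : Cube n → E) : noise 1 f = f := by
  funext x
  unfold noise
  rw [Finset.sum_eq_single x]
  · have : noiseKernel 1 x x = 1 := Finset.prod_eq_one fun i _ => by
      rw [noiseFactor, sgn'_mul_self]; norm_num
    simp [this]
  · intro y _ hy
    obtain ⟨i, hi⟩ := Function.ne_iff.1 hy
    have : noiseKernel 1 x y = 0 := by
      refine Finset.prod_eq_zero (Finset.mem_univ i) ?_
      revert hi
      cases x i <;> cases y i <;> simp [noiseFactor, sgn']
    simp [this]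
  · simp

lemma noise_zero {n : ℕ} [NormedSpace ℝ E] (f : Cube n → E) (x : Cube n) :
    noise 0 f x = cubeAvg f := by
  simp [noise, cubeAvg, noiseKernel, noiseFactor, Finset.smul_sum]

lemma flipC_apply {n : ℕ} (i : Fin n) (x : Cube n) : flipC i x i = !(x i) := by
  simp [flipC]

lemma flipC_apply_of_ne {n : ℕ} {i j : Fin n} (h : j ≠ i) (x : Cube n) :
    flipC i x j = x j := by
  simp [flipC, h]

lemma noiseKernel_flipC {n : ℕ} (ρ : ℝ) (i : Fin n) (x y : Cube n) :
    noiseKernel ρ (flipC i x) (flipC i y) = noiseKernel ρ x y := by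
  refine Finset.prod_congr rfl fun j _ => ?_
  by_cases h : j = i
  · subst h; simp [flipC_apply, noiseFactor, sgn'_not]
  · simp [flipC_apply_of_ne h]

lemma dparC_noise {n : ℕ} [NormedSpace ℝ E] (ρ : ℝ) (i : Fin n) (f : Cube n → E) :
    dparC i (noise ρ f) = noise ρ (dparC i f) := by
  funext x
  have h : noise ρ f (flipC i x) = ∑ y, noiseKernel ρ x y • f (flipC i y) := by
    unfold noise
    rw [← sum_flipC i]
    simp_rw [noiseKernel_flipC]
  rw [dparC, h]
  simp only [noise, dparC, ← Finset.sum_sub_distrib, Finset.smul_sum, ← smul_sub]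
  exact Finset.sum_congr rfl fun y _ => smul_comm _ _ _

lemma hasDerivAt_noiseKernel {n : ℕ} (ρ : ℝ) (x y : Cube n) :
    HasDerivAt (fun ρ => noiseKernel ρ x y) (noiseKernelDeriv ρ x y) ρ := by
  have := HasDerivAt.fun_finsetProd (u := univ) (x := ρ)
    (f := fun (i : Fin n) (ρ : ℝ) => noiseFactor ρ (x i) (y i))
    (f' := fun i => sgn' (x i) * sgn' (y i) / 2) (fun i _ => by
      have h := (((hasDerivAt_id ρ).mul_const (sgn' (x i) * sgn' (y i))).const_add 1).div_const 2
      simpa [noiseFactor] using h)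
  simpa [noiseKernel, noiseKernelDeriv] using this

lemma hasDerivAt_noise {n : ℕ} [NormedSpace ℝ E] (ρ : ℝ) (f : Cube n → E) (x : Cube n) :
    HasDerivAt (fun ρ => noise ρ f x) (noiseDeriv ρ f x) ρ :=
  HasDerivAt.fun_sum fun y _ => (hasDerivAt_noiseKernel ρ x y).smul_const (f y)

/-- The semigroup law, differentiated. -/
lemma smul_noiseDeriv_mul_self {n : ℕ} [NormedSpace ℝ E] (σ τ : ℝ) (f : Cube n → E)
    (x : Cube n) : τ • noiseDeriv (σ * τ) f x = noiseDeriv σ (noise τ f) x := by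
  have h1 : HasDerivAt (fun σ => noise (σ * τ) f x) (τ • noiseDeriv (σ * τ) f x) σ := by
    have := (hasDerivAt_noise (σ * τ) f x).scomp σ ((hasDerivAt_id σ).mul_const τ)
    simpa [Function.comp_def] using this
  have h2 := hasDerivAt_noise σ (noise τ f) x
  simp only [noise_noise] at h2
  exact h1.unique h2

/-- The derivative of the noise operator as an average of discrete derivatives. -/
lemma smul_noiseDeriv {n : ℕ} [NormedSpace ℝ E] (ρ : ℝ) (f : Cube n → E) (x : Cube n) :
    (1 - ρ ^ 2) • noiseDeriv ρ f x =
      ∑ y, noiseKernel ρ x y • ∑ i, (sgn' (x i) * sgn' (y i) - ρ) • dparC i f y := by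
  simp only [Finset.smul_sum, noiseDeriv, noiseKernelDeriv, Finset.sum_smul]
  rw [Finset.sum_comm, Finset.sum_comm (s := (univ : Finset (Cube n)))]
  refine Finset.sum_congr rfl fun i _ => ?_
  have hsplit : ∀ y : Cube n, noiseKernel ρ x y =
      (∏ j ∈ univ.erase i, noiseFactor ρ (x j) (y j)) * noiseFactor ρ (x i) (y i) := by
    intro y; rw [noiseKernel, Finset.prod_erase_mul _ _ (Finset.mem_univ i)]
  have hflip : ∀ y : Cube n, (∏ j ∈ univ.erase i, noiseFactor ρ (x j) (flipC i y j)) =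
      ∏ j ∈ univ.erase i, noiseFactor ρ (x j) (y j) := fun y =>
    Finset.prod_congr rfl fun j hj => by rw [flipC_apply_of_ne (Finset.ne_of_mem_erase hj)]
  simp only [dparC, smul_smul, smul_sub, Finset.sum_sub_distrib]
  rw [← sum_flipC i (fun y => (noiseKernel ρ x y * ((sgn' (x i) * sgn' (y i) - ρ) * 2⁻¹)) •
    f (flipC i y))]
  simp only [flipC_flipC, ← Finset.sum_sub_distrib, ← sub_smul]
  refine Finset.sum_congr rfl fun y _ => ?_
  congr 1
  rw [hsplit, hsplit, hflip, flipC_apply, noiseFactor, noiseFactor, sgn'_not]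
  ring

/-- Jensen's inequality for the squared norm of a weighted average. -/
lemma norm_sum_smul_sq_le {ι : Type*} [NormedSpace ℝ E] (s : Finset ι) (w : ι → ℝ) (v : ι → E)
    (hw : ∀ i ∈ s, 0 ≤ w i) (hw1 : ∑ i ∈ s, w i = 1) :
    ‖∑ i ∈ s, w i • v i‖ ^ 2 ≤ ∑ i ∈ s, w i * ‖v i‖ ^ 2 := by
  have h1 : ‖∑ i ∈ s, w i • v i‖ ≤ ∑ i ∈ s, w i * ‖v i‖ :=
    (norm_sum_le _ _).trans_eq (Finset.sum_congr rfl fun i hi => by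
      rw [norm_smul, Real.norm_of_nonneg (hw i hi)])
  calc ‖∑ i ∈ s, w i • v i‖ ^ 2 ≤ (∑ i ∈ s, w i * ‖v i‖) ^ 2 := by gcongr
    _ ≤ ∑ i ∈ s, w i * ‖v i‖ ^ 2 :=
      Real.pow_arith_mean_le_arith_mean_pow s w _ hw hw1 (fun _ _ => norm_nonneg _) 2

/-- Exchange the coordinates of two points of the cube where `r` is `false`. -/
def swapEquiv {n : ℕ} (r : Cube n) : Equiv.Perm (Cube n × Cube n) :=
  Function.Involutive.toPerm
    (fun p => (fun i => if r i then p.1 i else p.2 i, fun i => if r i then p.2 i else p.1 i))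
    (fun p => by
      ext i <;> by_cases h : r i <;> simp [h])

lemma swapEquiv_apply {n : ℕ} (r : Cube n) (p : Cube n × Cube n) :
    swapEquiv r p =
      (fun i => if r i then p.1 i else p.2 i, fun i => if r i then p.2 i else p.1 i) := rfl

/-- The type `2` inequality with constant `T`, for real scalars. -/
def HasTypeTwo (E : Type*) [NormedAddCommGroup E] [NormedSpace ℝ E] (T : ℝ) : Prop :=
  ∀ (m : ℕ) (v : Fin m → E),
    (2 ^ m : ℝ)⁻¹ * ∑ ε : Cube m, ‖∑ i, sgn' (ε i) • v i‖ ^ 2 ≤ T ^ 2 * ∑ i, ‖v i‖ ^ 2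

/-- Type `2` for the differences of two independent copies of biased signs. -/
lemma HasTypeTwo.sum_sub_le [NormedSpace ℝ E] {T : ℝ} (hE : HasTypeTwo E T) {n : ℕ} {ρ : ℝ}
    (h0 : 0 ≤ ρ) (h1 : ρ ≤ 1) (y : Cube n) (v : Fin n → E) :
    ∑ p : Cube n × Cube n, noiseKernel ρ p.1 y * noiseKernel ρ p.2 y *
        ‖∑ i, (sgn' (p.1 i) - sgn' (p.2 i)) • v i‖ ^ 2 ≤
      2 * T ^ 2 * (1 - ρ ^ 2) * ∑ i, ‖v i‖ ^ 2 := by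
  have hswap : ∀ r : Cube n,
      ∑ p : Cube n × Cube n, noiseKernel ρ p.1 y * noiseKernel ρ p.2 y *
        ‖∑ i, (sgn' (p.1 i) - sgn' (p.2 i)) • v i‖ ^ 2 =
      ∑ p : Cube n × Cube n, noiseKernel ρ p.1 y * noiseKernel ρ p.2 y *
        ‖∑ i, sgn' (r i) • (sgn' (p.1 i) - sgn' (p.2 i)) • v i‖ ^ 2 := by
    intro r
    rw [← Equiv.sum_comp (swapEquiv r)]
    refine Finset.sum_congr rfl fun p _ => ?_
    congr 1
    · simp only [swapEquiv_apply, noiseKernel, ← Finset.prod_mul_distrib]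
      refine Finset.prod_congr rfl fun i _ => ?_
      by_cases h : r i <;> simp [h, mul_comm]
    · congr 2
      refine Finset.sum_congr rfl fun i _ => ?_
      rw [smul_smul]
      congr 1
      simp only [swapEquiv_apply]
      by_cases h : r i <;> simp [h, sgn']
  have havg : ∑ p : Cube n × Cube n, noiseKernel ρ p.1 y * noiseKernel ρ p.2 y *
        ‖∑ i, (sgn' (p.1 i) - sgn' (p.2 i)) • v i‖ ^ 2 =
      ∑ p : Cube n × Cube n, noiseKernel ρ p.1 y * noiseKernel ρ p.2 y *
        ((2 ^ n : ℝ)⁻¹ * ∑ r : Cube n,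
          ‖∑ i, sgn' (r i) • (sgn' (p.1 i) - sgn' (p.2 i)) • v i‖ ^ 2) := by
    simp only [Finset.mul_sum]
    rw [Finset.sum_comm]
    simp only [mul_left_comm _ (2 ^ n : ℝ)⁻¹, ← Finset.mul_sum, ← hswap]
    simp
  rw [havg]
  have hsq : ∀ (a b : Bool), |sgn' a - sgn' b| ^ 2 = 2 - 2 * (sgn' a * sgn' b) := by
    intro a b; cases a <;> cases b <;> norm_num [sgn']
  have hcov : ∀ i, ∑ p : Cube n × Cube n, noiseKernel ρ p.1 y * noiseKernel ρ p.2 y *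
      |sgn' (p.1 i) - sgn' (p.2 i)| ^ 2 = 2 * (1 - ρ ^ 2) := by
    intro i
    have : ∀ p : Cube n × Cube n, noiseKernel ρ p.1 y * noiseKernel ρ p.2 y *
        |sgn' (p.1 i) - sgn' (p.2 i)| ^ 2 = 2 * (noiseKernel ρ p.1 y * noiseKernel ρ p.2 y) -
        2 * ((noiseKernel ρ p.1 y * sgn' (p.1 i)) * (noiseKernel ρ p.2 y * sgn' (p.2 i))) := by
      intro p; rw [hsq]; ring
    simp_rw [this, Finset.sum_sub_distrib, ← Finset.mul_sum, Fintype.sum_prod_type,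
      ← Finset.mul_sum, ← Finset.sum_mul, sum_noiseKernel, sum_noiseKernel_mul_sgn']
    linear_combination (-2 * ρ ^ 2) * sgn'_mul_self (y i)
  calc _ ≤ ∑ p : Cube n × Cube n, noiseKernel ρ p.1 y * noiseKernel ρ p.2 y *
        (T ^ 2 * ∑ i, ‖(sgn' (p.1 i) - sgn' (p.2 i)) • v i‖ ^ 2) := by
        refine Finset.sum_le_sum fun p _ => mul_le_mul_of_nonneg_left (hE n _) ?_
        exact mul_nonneg (noiseKernel_nonneg h0 h1 _ _) (noiseKernel_nonneg h0 h1 _ _)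
    _ = T ^ 2 * ∑ i, (∑ p : Cube n × Cube n, noiseKernel ρ p.1 y * noiseKernel ρ p.2 y *
          |sgn' (p.1 i) - sgn' (p.2 i)| ^ 2) * ‖v i‖ ^ 2 := by
        simp only [Finset.mul_sum, Finset.sum_mul, norm_smul, Real.norm_eq_abs, mul_pow]
        rw [Finset.sum_comm]
        exact Finset.sum_congr rfl fun i _ => Finset.sum_congr rfl fun p _ => by ring
    _ = _ := by
        simp_rw [hcov, ← Finset.mul_sum]; ring

/-- Type `2` for centred biased signs. -/
lemma HasTypeTwo.sum_biased_le [NormedSpace ℝ E] {T : ℝ} (hE : HasTypeTwo E T) {n : ℕ} {ρ : ℝ}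
    (h0 : 0 ≤ ρ) (h1 : ρ ≤ 1) (y : Cube n) (v : Fin n → E) :
    ∑ x, noiseKernel ρ x y * ‖∑ i, (sgn' (x i) * sgn' (y i) - ρ) • v i‖ ^ 2 ≤
      2 * T ^ 2 * (1 - ρ ^ 2) * ∑ i, ‖v i‖ ^ 2 := by
  have h := hE.sum_sub_le h0 h1 y (fun i => sgn' (y i) • v i)
  simp only [norm_smul, Real.norm_eq_abs, abs_sgn', one_mul] at h
  refine le_trans ?_ h
  rw [Fintype.sum_prod_type]
  refine Finset.sum_le_sum fun x _ => ?_
  simp only [mul_assoc, ← Finset.mul_sum]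
  refine mul_le_mul_of_nonneg_left ?_ (noiseKernel_nonneg h0 h1 _ _)
  have hmean : ∑ i, (sgn' (x i) * sgn' (y i) - ρ) • v i =
      ∑ x', noiseKernel ρ x' y • ∑ i, (sgn' (x i) - sgn' (x' i)) • sgn' (y i) • v i := by
    simp only [Finset.smul_sum, smul_smul]
    rw [Finset.sum_comm]
    refine Finset.sum_congr rfl fun i _ => ?_
    rw [← Finset.sum_smul]
    congr 1
    have : ∀ x' : Cube n, noiseKernel ρ x' y * ((sgn' (x i) - sgn' (x' i)) * sgn' (y i)) =
        noiseKernel ρ x' y * (sgn' (x i) * sgn' (y i)) -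
          noiseKernel ρ x' y * sgn' (x' i) * sgn' (y i) := fun x' => by ring
    simp_rw [this, Finset.sum_sub_distrib, ← Finset.sum_mul, sum_noiseKernel,
      sum_noiseKernel_mul_sgn']
    linear_combination ρ * sgn'_mul_self (y i)
  rw [hmean]
  exact norm_sum_smul_sq_le _ _ _ (fun _ _ => noiseKernel_nonneg h0 h1 _ _) (sum_noiseKernel ρ y)

/-- The `L₂` bound for the derivative of the noise operator in a space of type `2`. -/
lemma HasTypeTwo.sum_noiseDeriv_le [NormedSpace ℝ E] {T : ℝ} (hE : HasTypeTwo E T) {n : ℕ} {ρ : ℝ}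
    (h0 : 0 ≤ ρ) (h1 : ρ < 1) (f : Cube n → E) :
    (1 - ρ ^ 2) * ∑ x, ‖noiseDeriv ρ f x‖ ^ 2 ≤
      2 * T ^ 2 * ∑ i, ∑ x, ‖dparC i f x‖ ^ 2 := by
  have hpos : 0 < 1 - ρ ^ 2 := by nlinarith
  refine le_of_mul_le_mul_left ?_ hpos
  calc (1 - ρ ^ 2) * ((1 - ρ ^ 2) * ∑ x, ‖noiseDeriv ρ f x‖ ^ 2)
      = ∑ x, ‖(1 - ρ ^ 2) • noiseDeriv ρ f x‖ ^ 2 := by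
        simp only [norm_smul, mul_pow, Real.norm_eq_abs, sq_abs, ← Finset.mul_sum]; ring
    _ ≤ ∑ x, ∑ y, noiseKernel ρ x y *
          ‖∑ i, (sgn' (x i) * sgn' (y i) - ρ) • dparC i f y‖ ^ 2 := by
        refine Finset.sum_le_sum fun x _ => ?_
        rw [smul_noiseDeriv]
        exact norm_sum_smul_sq_le _ _ _ (fun _ _ => noiseKernel_nonneg h0 h1.le _ _)
          (sum_noiseKernel_right ρ x)
    _ = ∑ y, ∑ x, noiseKernel ρ x y *
          ‖∑ i, (sgn' (x i) * sgn' (y i) - ρ) • dparC i f y‖ ^ 2 := Finset.sum_comm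
    _ ≤ ∑ y, 2 * T ^ 2 * (1 - ρ ^ 2) * ∑ i, ‖dparC i f y‖ ^ 2 :=
        Finset.sum_le_sum fun y _ => hE.sum_biased_le h0 h1.le y _
    _ = _ := by
        rw [← Finset.mul_sum, Finset.sum_comm]; ring

lemma sum_cube_succ {n : ℕ} (F : Cube (n + 1) → ℝ) :
    ∑ x, F x = ∑ x : Cube n, (F (Fin.cons true x) + F (Fin.cons false x)) := by
  rw [← Equiv.sum_comp (Fin.consEquiv fun _ : Fin (n + 1) => Bool), Fintype.sum_prod_type,
    Fintype.sum_bool, ← Finset.sum_add_distrib]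
  rfl

lemma noiseKernel_cons {n : ℕ} (ρ : ℝ) (a b : Bool) (x y : Cube n) :
    noiseKernel (n := n + 1) ρ (Fin.cons a x) (Fin.cons b y) =
      noiseFactor ρ a b * noiseKernel ρ x y := by
  simp [noiseKernel, Fin.prod_univ_succ]

lemma noise_cons {n : ℕ} (ρ : ℝ) (h : Cube (n + 1) → ℝ) (b : Bool) (x : Cube n) :
    noise ρ h (Fin.cons b x) =
      noise ρ (fun y => (h (Fin.cons true y) + h (Fin.cons false y)) / 2) x +
      ρ * sgn' b * noise ρ (fun y => (h (Fin.cons true y) - h (Fin.cons false y)) / 2) x := by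
  simp only [noise, smul_eq_mul]
  rw [sum_cube_succ, Finset.mul_sum, ← Finset.sum_add_distrib]
  refine Finset.sum_congr rfl fun y _ => ?_
  rw [noiseKernel_cons, noiseKernel_cons]
  cases b <;> simp [noiseFactor, sgn'] <;> ring

/-- Bonami's `(2, 4)`-hypercontractive inequality. -/
lemma bonami_two_four {ρ : ℝ} (hρ : ρ ^ 2 = 1 / 3) :
    ∀ (n : ℕ) (h : Cube n → ℝ), 2 ^ n * ∑ x, noise ρ h x ^ 4 ≤ (∑ x, h x ^ 2) ^ 2 := by
  intro n
  induction n with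
  | zero =>
    intro h
    simp [noise, noiseKernel]
    exact le_of_eq (by ring)
  | succ n ih =>
    intro h
    set a : Cube n → ℝ := fun y => (h (Fin.cons true y) + h (Fin.cons false y)) / 2 with ha
    set d : Cube n → ℝ := fun y => (h (Fin.cons true y) - h (Fin.cons false y)) / 2 with hd
    have hL : ∑ x, noise ρ h x ^ 4 = 2 * ∑ x, noise ρ a x ^ 4 +
        4 * ∑ x, noise ρ a x ^ 2 * noise ρ d x ^ 2 + 2 / 9 * ∑ x, noise ρ d x ^ 4 := by
      rw [sum_cube_succ, Finset.mul_sum, Finset.mul_sum, Finset.mul_sum,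
        ← Finset.sum_add_distrib, ← Finset.sum_add_distrib]
      refine Finset.sum_congr rfl fun x _ => ?_
      rw [noise_cons, noise_cons, ← ha, ← hd]
      simp only [sgn', if_true, Bool.false_eq_true, if_false]
      generalize noise ρ a x = A
      generalize noise ρ d x = D
      linear_combination (12 * A ^ 2 * D ^ 2 + 2 * D ^ 4 * (ρ ^ 2 + 1 / 3)) * hρ
    have hR : ∑ x, h x ^ 2 = 2 * (∑ x, a x ^ 2 + ∑ x, d x ^ 2) := by
      rw [sum_cube_succ, ← Finset.sum_add_distrib, Finset.mul_sum]
      refine Finset.sum_congr rfl fun x _ => ?_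
      simp only [ha, hd]; ring
    have hA := ih a
    have hD := ih d
    have hcs : 2 ^ n * ∑ x, noise ρ a x ^ 2 * noise ρ d x ^ 2 ≤
        (∑ x, a x ^ 2) * ∑ x, d x ^ 2 := by
      refine le_of_pow_le_pow_left₀ two_ne_zero (by positivity) ?_
      have := Finset.sum_mul_sq_le_sq_mul_sq univ (fun x => noise ρ a x ^ 2)
        (fun x => noise ρ d x ^ 2)
      simp only [← pow_mul] at this
      norm_num at this
      calc (2 ^ n * ∑ x, noise ρ a x ^ 2 * noise ρ d x ^ 2) ^ 2
          = (2 ^ n) ^ 2 * (∑ x, noise ρ a x ^ 2 * noise ρ d x ^ 2) ^ 2 := by ring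
        _ ≤ (2 ^ n) ^ 2 * ((∑ x, noise ρ a x ^ 4) * ∑ x, noise ρ d x ^ 4) := by gcongr
        _ = (2 ^ n * ∑ x, noise ρ a x ^ 4) * (2 ^ n * ∑ x, noise ρ d x ^ 4) := by ring
        _ ≤ (∑ x, a x ^ 2) ^ 2 * (∑ x, d x ^ 2) ^ 2 := by gcongr
        _ = _ := by ring
    have hD0 : 0 ≤ (2 : ℝ) ^ n * ∑ x, noise ρ d x ^ 4 := by positivity
    rw [hL, hR, pow_succ]
    nlinarith

lemma sum_noise_mul {n : ℕ} (ρ : ℝ) (g h : Cube n → ℝ) :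
    ∑ x, noise ρ g x * h x = ∑ x, g x * noise ρ h x := by
  simp only [noise, smul_eq_mul, Finset.mul_sum, Finset.sum_mul]
  rw [Finset.sum_comm]
  refine Finset.sum_congr rfl fun x _ => Finset.sum_congr rfl fun y _ => ?_
  rw [noiseKernel_comm]; ring

lemma sum_noise_sq_eq {n : ℕ} (ρ : ℝ) (g : Cube n → ℝ) :
    ∑ x, noise ρ g x ^ 2 = ∑ x, g x * noise (ρ ^ 2) g x := by
  simp_rw [sq, sum_noise_mul ρ g (noise ρ g), noise_noise]

lemma sum_norm_noise_sq_le [NormedSpace ℝ E] {n : ℕ} {ρ : ℝ} (h0 : 0 ≤ ρ) (h1 : ρ ≤ 1)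
    (f : Cube n → E) : ∑ x, ‖noise ρ f x‖ ^ 2 ≤ ∑ x, ‖f x‖ ^ 2 := by
  calc ∑ x, ‖noise ρ f x‖ ^ 2 ≤ ∑ x, ∑ y, noiseKernel ρ x y * ‖f y‖ ^ 2 :=
        Finset.sum_le_sum fun x _ => norm_sum_smul_sq_le _ _ _
          (fun _ _ => noiseKernel_nonneg h0 h1 _ _) (sum_noiseKernel_right ρ x)
    _ = _ := by
        rw [Finset.sum_comm]
        simp_rw [← Finset.sum_mul, sum_noiseKernel, one_mul]

lemma sum_noise_sq_mono {n : ℕ} {ρ τ : ℝ} (h0 : 0 ≤ ρ) (h1 : ρ ≤ τ) (g : Cube n → ℝ) :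
    ∑ x, noise ρ g x ^ 2 ≤ ∑ x, noise τ g x ^ 2 := by
  rcases h0.eq_or_lt with rfl | hpos
  · rcases h1.eq_or_lt with rfl | hτ
    · exact le_rfl
    · have := sum_norm_noise_sq_le le_rfl zero_le_one (noise τ g)
      simpa [noise_noise] using this
  · have hτ : 0 < τ := hpos.trans_le h1
    have := sum_norm_noise_sq_le (div_nonneg h0 hτ.le) ((div_le_one hτ).2 h1) (noise τ g)
    simpa [noise_noise, div_mul_cancel₀ _ hτ.ne'] using this

lemma sum_noise_sq_sq_le {n : ℕ} (ρ : ℝ) (g : Cube n → ℝ) :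
    (∑ x, noise ρ g x ^ 2) ^ 2 ≤ (∑ x, g x ^ 2) * ∑ x, noise (ρ ^ 2) g x ^ 2 := by
  rw [sum_noise_sq_eq]
  exact Finset.sum_mul_sq_le_sq_mul_sq _ _ _

lemma sum_noise_sq_pow_le {n : ℕ} (ρ : ℝ) (g : Cube n → ℝ) (hg : 0 < ∑ x, g x ^ 2) (k : ℕ) :
    ((∑ x, noise ρ g x ^ 2) / ∑ x, g x ^ 2) ^ 2 ^ k ≤
      (∑ x, noise (ρ ^ 2 ^ k) g x ^ 2) / ∑ x, g x ^ 2 := by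
  induction k with
  | zero => simp
  | succ k ih =>
    rw [pow_succ, pow_mul, pow_mul]
    refine (pow_le_pow_left₀ (by positivity) ih 2).trans ?_
    rw [div_pow, div_le_div_iff₀ (by positivity) hg]
    have := sum_noise_sq_sq_le (ρ ^ 2 ^ k) g
    nlinarith

/-- At correlation `1 / √3`, the `L₂` norm is controlled by the `L₁` and `L₂` norms. -/
lemma sum_noise_sq_sq_le_of_sq_eq {n : ℕ} {ρ : ℝ} (hρ : ρ ^ 2 = 1 / 3) (g : Cube n → ℝ)
    (hg : ∀ x, 0 ≤ g x) :
    2 ^ n * (∑ x, noise ρ g x ^ 2) ^ 2 ≤ (∑ x, g x) ^ 2 * ∑ x, g x ^ 2 := by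
  set N := ∑ x, noise ρ g x ^ 2 with hN
  set h := noise ρ (noise ρ g) with hh
  have hNe : N = ∑ x, g x * h x := by
    rw [hN, sum_noise_sq_eq, hh, noise_noise, sq]
  have h4 : 2 ^ n * ∑ x, h x ^ 4 ≤ N ^ 2 := bonami_two_four hρ n (noise ρ g)
  have hN0 : 0 ≤ N := Finset.sum_nonneg fun _ _ => sq_nonneg _
  have c1 : N ^ 2 ≤ (∑ x, g x) * ∑ x, g x * h x ^ 2 := by
    have := Finset.sum_mul_sq_le_sq_mul_sq univ (fun x => √(g x)) (fun x => √(g x) * h x)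
    simp only [mul_pow, ← mul_assoc, Real.mul_self_sqrt (hg _), Real.sq_sqrt (hg _)] at this
    rwa [hNe]
  have c2 : (∑ x, g x * h x ^ 2) ^ 2 ≤ (∑ x, g x ^ 2) * ∑ x, h x ^ 4 := by
    have := Finset.sum_mul_sq_le_sq_mul_sq univ g (fun x => h x ^ 2)
    simpa only [← pow_mul] using this
  rcases hN0.eq_or_lt with h0 | hpos
  · rw [← h0]; simp; positivity
  refine le_of_mul_le_mul_right ?_ (pow_pos hpos 2)
  calc 2 ^ n * N ^ 2 * N ^ 2 = 2 ^ n * (N ^ 2) ^ 2 := by ring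
    _ ≤ 2 ^ n * ((∑ x, g x) * ∑ x, g x * h x ^ 2) ^ 2 := by gcongr
    _ = 2 ^ n * ((∑ x, g x) ^ 2 * (∑ x, g x * h x ^ 2) ^ 2) := by ring
    _ ≤ 2 ^ n * ((∑ x, g x) ^ 2 * ((∑ x, g x ^ 2) * ∑ x, h x ^ 4)) := by gcongr
    _ = (∑ x, g x) ^ 2 * (∑ x, g x ^ 2) * (2 ^ n * ∑ x, h x ^ 4) := by ring
    _ ≤ (∑ x, g x) ^ 2 * (∑ x, g x ^ 2) * N ^ 2 := by gcongr

/-- Decay of the noise operator in `L₂`, in terms of the ratio `exp L` of the normalised `L₂` and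
`L₁` norms. -/
lemma sum_noise_sq_le_exp {n : ℕ} {ρ L : ℝ} (h0 : 0 ≤ ρ) (h1 : ρ < 1) (hL : 0 ≤ L)
    (g : Cube n → ℝ) (hg : ∀ x, 0 ≤ g x)
    (hgL : Real.exp L ^ 2 * (∑ x, g x) ^ 2 ≤ 2 ^ n * ∑ x, g x ^ 2) :
    ∑ x, noise ρ g x ^ 2 ≤ Real.exp (-(L * (1 - ρ) / 2)) * ∑ x, g x ^ 2 := by
  have hM0 : 0 ≤ ∑ x, g x ^ 2 := Finset.sum_nonneg fun _ _ => sq_nonneg _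
  rcases hM0.eq_or_lt with hM | hM
  · have := sum_norm_noise_sq_le h0 h1.le g
    simp only [Real.norm_eq_abs, sq_abs] at this
    simpa [← hM] using this
  set M := ∑ x, g x ^ 2 with hMdef
  have hu : 0 < 1 - ρ := by linarith
  obtain ⟨k, hk1, hk2⟩ := exists_nat_pow_near (x := 1 / (1 - ρ)) (y := (2 : ℝ))
    (by rw [le_div_iff₀ hu]; linarith) one_lt_two
  rw [le_div_iff₀ hu] at hk1
  rw [div_lt_iff₀ hu] at hk2
  have hsmall : ρ ^ 2 ^ (k + 1) ≤ √(1 / 3) := by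
    have e1 : ρ ≤ Real.exp (-(1 - ρ)) := by
      have := Real.add_one_le_exp (-(1 - ρ)); linarith
    refine (pow_le_pow_left₀ h0 e1 _).trans ?_
    rw [← Real.exp_nat_mul]
    refine (Real.exp_le_exp.2 (show _ ≤ -1 by push_cast; linarith)).trans ?_
    refine Real.le_sqrt_of_sq_le ?_
    rw [← Real.exp_nat_mul]
    have := Real.add_one_le_exp 2
    rw [show ((2 : ℕ) : ℝ) * -1 = -2 by norm_num, Real.exp_neg, one_div]
    gcongr
    linarith
  have hρ0 : √(1 / 3 : ℝ) ^ 2 = 1 / 3 := Real.sq_sqrt (by norm_num)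
  have hr0 : (∑ x, noise (√(1 / 3)) g x ^ 2) / M ≤ Real.exp (-L) := by
    rw [div_le_iff₀ hM]
    refine le_of_pow_le_pow_left₀ two_ne_zero (by positivity) ?_
    have hb := sum_noise_sq_sq_le_of_sq_eq hρ0 g hg
    rw [← hMdef] at hb
    have hexp : Real.exp L * Real.exp (-L) = 1 := by rw [← Real.exp_add]; simp
    have h2n : (0 : ℝ) < 2 ^ n := by positivity
    refine le_of_mul_le_mul_left (hb.trans ?_) h2n
    calc (∑ x, g x) ^ 2 * M
        = (Real.exp L * Real.exp (-L)) ^ 2 * ((∑ x, g x) ^ 2 * M) := by rw [hexp]; ring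
      _ = (Real.exp L ^ 2 * (∑ x, g x) ^ 2) * (Real.exp (-L) ^ 2 * M) := by ring
      _ ≤ (2 ^ n * M) * (Real.exp (-L) ^ 2 * M) := by gcongr
      _ = _ := by ring
  rw [← div_le_iff₀ hM]
  refine le_of_pow_le_pow_left₀ (n := 2 ^ (k + 1)) (by positivity) (by positivity) ?_
  calc ((∑ x, noise ρ g x ^ 2) / M) ^ 2 ^ (k + 1)
      ≤ (∑ x, noise (ρ ^ 2 ^ (k + 1)) g x ^ 2) / M := sum_noise_sq_pow_le ρ g hM (k + 1)
    _ ≤ (∑ x, noise (√(1 / 3)) g x ^ 2) / M := by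
        gcongr ?_ / _
        exact sum_noise_sq_mono (by positivity) hsmall g
    _ ≤ Real.exp (-L) := hr0
    _ ≤ Real.exp (-(L * (1 - ρ) / 2)) ^ 2 ^ (k + 1) := by
        rw [← Real.exp_nat_mul]
        refine Real.exp_le_exp.2 ?_
        push_cast
        rw [pow_succ]
        nlinarith

/-- The vector-valued form of the decay estimate. -/
lemma sum_norm_noise_sq_le_exp [NormedSpace ℝ E] {n : ℕ} {ρ L : ℝ} (h0 : 0 ≤ ρ) (h1 : ρ < 1)
    (hL : 0 ≤ L) (f : Cube n → E)
    (hfL : Real.exp L ^ 2 * (∑ x, ‖f x‖) ^ 2 ≤ 2 ^ n * ∑ x, ‖f x‖ ^ 2) :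
    ∑ x, ‖noise ρ f x‖ ^ 2 ≤ Real.exp (-(L * (1 - ρ) / 2)) * ∑ x, ‖f x‖ ^ 2 := by
  refine le_trans ?_ (sum_noise_sq_le_exp h0 h1 hL (fun x => ‖f x‖) (fun _ => norm_nonneg _) hfL)
  refine Finset.sum_le_sum fun x _ => ?_
  gcongr
  refine (norm_sum_le _ _).trans_eq (Finset.sum_congr rfl fun y _ => ?_)
  rw [norm_smul, Real.norm_of_nonneg (noiseKernel_nonneg h0 h1.le _ _), smul_eq_mul]

/-- An antiderivative of a function comparable with `u ^ (-ε) * exp (-L * u / 2)`. -/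
lemma hasDerivAt_div_rpow {ε L u : ℝ} (hL : 0 ≤ L) (hu : 0 < u) :
    HasDerivAt (fun u => (u / (1 + L * u)) ^ (1 - ε))
      (1 / (1 + L * u) ^ 2 * (1 - ε) * (u / (1 + L * u)) ^ (-ε)) u := by
  have hpos : 0 < 1 + L * u := by positivity
  have h1 : HasDerivAt (fun u => u / (1 + L * u)) (1 / (1 + L * u) ^ 2) u := by
    refine ((hasDerivAt_id' u).fun_div (((hasDerivAt_id' u).const_mul L).const_add 1)
      hpos.ne').congr_deriv ?_
    ring
  refine (h1.rpow_const (p := 1 - ε) (Or.inl (div_pos hu hpos).ne')).congr_deriv ?_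
  congr 2
  ring

lemma exp_neg_half_le {x : ℝ} (hx : 0 ≤ x) : Real.exp (-(x / 2)) ≤ 16 * (1 / (1 + x) ^ 2) := by
  have h1 : 1 + x / 4 ≤ Real.exp (x / 4) := by linarith [Real.add_one_le_exp (x / 4)]
  have h2 : Real.exp (x / 2) = Real.exp (x / 4) ^ 2 := by
    rw [← Real.exp_nat_mul]; congr 1; push_cast; ring
  have h3 : (1 + x) ^ 2 / 16 ≤ Real.exp (x / 2) := by
    rw [h2]; nlinarith
  rw [Real.exp_neg, ← div_eq_mul_one_div, ← inv_div _ (16 : ℝ)]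
  exact inv_anti₀ (by positivity) h3

/-- The noise evolution from the mean of `f` to `f`, as a curve in `L₂`. -/
def noiseCurve {n : ℕ} [NormedSpace ℝ E] (f : Cube n → E) (ρ : ℝ) :
    PiLp 2 (fun _ : Cube n => E) :=
  WithLp.toLp 2 fun x => noise (ρ ^ 2) f x - cubeAvg f

lemma hasDerivAt_noiseCurve {n : ℕ} [NormedSpace ℝ E] (f : Cube n → E) (ρ : ℝ) :
    HasDerivAt (noiseCurve f)
      (WithLp.toLp 2 fun x => (2 : ℝ) • noiseDeriv ρ (noise ρ f) x) ρ := by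
  have h : HasDerivAt (fun ρ => fun x => noise (ρ ^ 2) f x - cubeAvg f)
      (fun x => (2 : ℝ) • noiseDeriv ρ (noise ρ f) x) ρ := by
    refine hasDerivAt_pi.2 fun x => ?_
    refine (((hasDerivAt_noise (ρ ^ 2) f x).scomp ρ (hasDerivAt_pow 2 ρ)).sub_const
      (cubeAvg f)).congr_deriv ?_
    rw [sq ρ]
    rw [← smul_noiseDeriv_mul_self, smul_smul]
    norm_num
  exact (PiLp.hasFDerivAt_toLp (𝕜 := ℝ) 2 _).comp_hasDerivAt ρ h

lemma norm_deriv_noiseCurve_sq_le [NormedSpace ℝ E] {T : ℝ} (hE : HasTypeTwo E T) {n : ℕ}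
    (f : Cube n → E) {L : Fin n → ℝ} (hL : ∀ i, 0 ≤ L i)
    (hfL : ∀ i, Real.exp (L i) ^ 2 * (∑ x, ‖dparC i f x‖) ^ 2 ≤
      2 ^ n * ∑ x, ‖dparC i f x‖ ^ 2) {ρ : ℝ} (h0 : 0 ≤ ρ) (h1 : ρ < 1) :
    (1 - ρ) * ‖(WithLp.toLp 2 fun x => (2 : ℝ) • noiseDeriv ρ (noise ρ f) x :
      PiLp 2 (fun _ : Cube n => E))‖ ^ 2 ≤
      8 * T ^ 2 * ∑ i, Real.exp (-(L i * (1 - ρ) / 2)) * ∑ x, ‖dparC i f x‖ ^ 2 := by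
  rw [PiLp.norm_sq_eq_of_L2]
  simp only [norm_smul, mul_pow, ← Finset.mul_sum]
  have h := hE.sum_noiseDeriv_le h0 h1 (noise ρ f)
  simp only [dparC_noise] at h
  have h2 : ∑ i, ∑ x, ‖noise ρ (dparC i f) x‖ ^ 2 ≤
      ∑ i, Real.exp (-(L i * (1 - ρ) / 2)) * ∑ x, ‖dparC i f x‖ ^ 2 :=
    Finset.sum_le_sum fun i _ => sum_norm_noise_sq_le_exp h0 h1 (hL i) _ (hfL i)
  have h3 : 0 ≤ ∑ x, ‖noiseDeriv ρ (noise ρ f) x‖ ^ 2 := by positivity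
  have h4 : (1 - ρ) * ∑ x, ‖noiseDeriv ρ (noise ρ f) x‖ ^ 2 ≤
      (1 - ρ ^ 2) * ∑ x, ‖noiseDeriv ρ (noise ρ f) x‖ ^ 2 := by
    gcongr; nlinarith
  have h5 := mul_le_mul_of_nonneg_left h2 (by positivity : 0 ≤ 2 * T ^ 2)
  norm_num
  linarith

/-- Integrated form of the derivative bound, with a free parameter `l`. -/
lemma HasTypeTwo.sqrt_sum_le [NormedSpace ℝ E] {T : ℝ} (hT : 0 < T) (hE : HasTypeTwo E T) {n : ℕ}
    (f : Cube n → E) {L : Fin n → ℝ} (hL : ∀ i, 0 ≤ L i)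
    (hfL : ∀ i, Real.exp (L i) ^ 2 * (∑ x, ‖dparC i f x‖) ^ 2 ≤
      2 ^ n * ∑ x, ‖dparC i f x‖ ^ 2) {ε : ℝ} (hε : 0 < ε) (hε1 : ε < 1) {l : ℝ} (hl : 0 < l) :
    √(∑ x, ‖f x - cubeAvg f‖ ^ 2) ≤ 2 * T * (l / ε + 16 / (1 - ε) / l *
      ∑ i, (∑ x, ‖dparC i f x‖ ^ 2) * (1 / (1 + L i)) ^ (1 - ε)) := by
  set a : Fin n → ℝ := fun i => ∑ x, ‖dparC i f x‖ ^ 2 with ha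
  have ha0 : ∀ i, 0 ≤ a i := fun i => Finset.sum_nonneg fun _ _ => sq_nonneg _
  have hε2 : 0 < 1 - ε := by linarith
  set G : ℝ → ℝ := fun u => 2 * T * (l / ε * u ^ ε + 16 / (1 - ε) / l *
      ∑ i, a i * (u / (1 + L i * u)) ^ (1 - ε)) with hG
  set G' : ℝ → ℝ := fun u => 2 * T * (l * u ^ (ε - 1) + 16 / l *
      ∑ i, a i * (1 / (1 + L i * u) ^ 2 * (u / (1 + L i * u)) ^ (-ε))) with hG'
  have hGd : ∀ u, 0 < u → HasDerivAt G (G' u) u := by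
    intro u hu
    have h1 := (Real.hasDerivAt_rpow_const (p := ε) (Or.inl hu.ne')).const_mul (l / ε)
    have h2 := (HasDerivAt.fun_sum (u := univ) fun i _ =>
      (hasDerivAt_div_rpow (ε := ε) (hL i) hu).const_mul (a i)).const_mul (16 / (1 - ε) / l)
    refine ((h1.fun_add h2).const_mul (2 * T)).congr_deriv ?_
    simp only [hG', Finset.mul_sum]
    congr 2
    · field_simp
    · refine Finset.sum_congr rfl fun i _ => ?_
      field_simp
  have hGc : ContinuousOn G (Set.Icc 0 1) := by
    refine ContinuousOn.mul continuousOn_const (ContinuousOn.add ?_ ?_)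
    · exact continuousOn_const.mul (continuousOn_id.rpow_const fun _ _ => Or.inr hε.le)
    · refine continuousOn_const.mul (continuousOn_finsetSum _ fun i _ => continuousOn_const.mul ?_)
      refine ContinuousOn.rpow_const (ContinuousOn.div continuousOn_id (by fun_prop) ?_)
        fun _ _ => Or.inr hε2.le
      intro u hu
      have := mul_nonneg (hL i) hu.1
      positivity
  have hG0 : G 0 = 0 := by
    simp [hG, Real.zero_rpow hε.ne', Real.zero_rpow hε2.ne']
  have hbound : ∀ ρ ∈ Set.Ico (0 : ℝ) 1,
      ‖(WithLp.toLp 2 fun x => (2 : ℝ) • noiseDeriv ρ (noise ρ f) x :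
        PiLp 2 (fun _ : Cube n => E))‖ ≤ G' (1 - ρ) := by
    intro ρ hρ
    have hu : 0 < 1 - ρ := by linarith [hρ.2]
    have hd := norm_deriv_noiseCurve_sq_le hE f hL hfL hρ.1 hρ.2
    generalize ‖(WithLp.toLp 2 fun x => (2 : ℝ) • noiseDeriv ρ (noise ρ f) x :
        PiLp 2 (fun _ : Cube n => E))‖ = D at hd ⊢
    set u := 1 - ρ with hudef
    set X := l * u ^ (ε - 1) with hX
    set Y := 16 / l * ∑ i, a i * (1 / (1 + L i * u) ^ 2 * (u / (1 + L i * u)) ^ (-ε)) with hY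
    have hX0 : 0 < X := by positivity
    have hY1 : u ^ (-ε) / l * ∑ i, Real.exp (-(L i * u / 2)) * a i ≤ Y := by
      rw [hY, Finset.mul_sum, Finset.mul_sum]
      refine Finset.sum_le_sum fun i _ => ?_
      have hLu : 0 ≤ L i * u := mul_nonneg (hL i) hu.le
      have e1 := exp_neg_half_le hLu
      have e2 : u ^ (-ε) ≤ (u / (1 + L i * u)) ^ (-ε) :=
        Real.rpow_le_rpow_of_nonpos (by positivity) (div_le_self hu.le (by linarith)) (by linarith)
      calc u ^ (-ε) / l * (Real.exp (-(L i * u / 2)) * a i)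
          ≤ (u / (1 + L i * u)) ^ (-ε) / l * (16 * (1 / (1 + L i * u) ^ 2) * a i) := by
            have := ha0 i
            gcongr
        _ = _ := by ring
    have hXY : ∑ i, Real.exp (-(L i * u / 2)) * a i ≤ u * (X * Y) := by
      have h := mul_le_mul_of_nonneg_left hY1 (mul_nonneg hu.le hX0.le)
      have e : u * X * (u ^ (-ε) / l) = 1 := by
        rw [hX, Real.rpow_sub_one hu.ne', Real.rpow_neg hu.le]
        have := (Real.rpow_pos_of_pos hu ε).ne'
        field_simp
      rw [← mul_assoc, e, one_mul] at h
      linarith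
    have hY0 : 0 ≤ Y := by
      refine le_trans ?_ hY1
      have := Finset.sum_nonneg (s := univ) fun i (_ : i ∈ univ) =>
        mul_nonneg (Real.exp_pos (-(L i * u / 2))).le (ha0 i)
      positivity
    have hD : D ^ 2 ≤ 8 * T ^ 2 * (X * Y) := by
      refine le_of_mul_le_mul_left (hd.trans ?_) hu
      calc _ ≤ 8 * T ^ 2 * (u * (X * Y)) := by gcongr
        _ = _ := by ring
    change D ≤ 2 * T * (X + Y)
    refine le_of_sq_le_sq (hD.trans ?_) (by positivity)
    nlinarith [mul_nonneg (sq_nonneg T) (sq_nonneg (X - Y)), mul_nonneg (sq_nonneg T)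
      (mul_nonneg hX0.le hY0), mul_nonneg (sq_nonneg T) (add_nonneg (sq_nonneg X) (sq_nonneg Y))]
  have hsub : ∀ ρ : ℝ, HasDerivAt (fun ρ : ℝ => 1 - ρ) (-1) ρ := fun ρ => by
    simpa using (hasDerivAt_id ρ).const_sub 1
  have hmain := image_norm_le_of_norm_deriv_right_le_deriv_boundary'
    (f := noiseCurve f) (a := 0) (b := 1)
    (f' := fun ρ => WithLp.toLp 2 fun x => (2 : ℝ) • noiseDeriv ρ (noise ρ f) x)
    (B := fun ρ => G 1 - G (1 - ρ)) (B' := fun ρ => G' (1 - ρ))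
    (fun ρ _ => (hasDerivAt_noiseCurve f ρ).continuousAt.continuousWithinAt)
    (fun ρ _ => (hasDerivAt_noiseCurve f ρ).hasDerivWithinAt)
    (by simp [noiseCurve, noise_zero, ← Pi.zero_def])
    (continuousOn_const.sub (hGc.comp (by fun_prop) fun ρ hρ => ⟨by linarith [hρ.2],
      by linarith [hρ.1]⟩))
    (fun ρ hρ => by
      have := ((hGd (1 - ρ) (by linarith [hρ.2])).comp ρ (hsub ρ)).const_sub (G 1)
      simpa [Function.comp_def] using this.hasDerivWithinAt)
    hbound (Set.right_mem_Icc.2 zero_le_one)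
  rw [PiLp.norm_eq_of_L2] at hmain
  simpa [noiseCurve, noise_one, hG0, hG, Real.zero_rpow hε.ne', Real.zero_rpow hε2.ne'] using hmain

/-- The influence inequality for unnormalised sums. -/
lemma HasTypeTwo.sum_sub_cubeAvg_le [NormedSpace ℝ E] {T : ℝ} (hT : 0 < T) (hE : HasTypeTwo E T)
    {n : ℕ} (f : Cube n → E) {L : Fin n → ℝ} (hL : ∀ i, 0 ≤ L i)
    (hfL : ∀ i, Real.exp (L i) ^ 2 * (∑ x, ‖dparC i f x‖) ^ 2 ≤
      2 ^ n * ∑ x, ‖dparC i f x‖ ^ 2) {ε : ℝ} (hε : 0 < ε) (hε1 : ε < 1) :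
    ∑ x, ‖f x - cubeAvg f‖ ^ 2 ≤ 2048 * T ^ 2 / ε *
      ∑ i, (∑ x, ‖dparC i f x‖ ^ 2) / (1 + L i ^ (1 - ε)) := by
  set S := ∑ i, (∑ x, ‖dparC i f x‖ ^ 2) / (1 + L i ^ (1 - ε)) with hS
  have hS0 : 0 ≤ S := Finset.sum_nonneg fun i _ => by
    have := Real.rpow_nonneg (hL i) (1 - ε)
    positivity
  set δ := min ε (1 / 2) with hδ
  have hδ0 : 0 < δ := lt_min hε (by norm_num)
  have hδε : δ ≤ ε := min_le_left _ _
  have hδ2 : δ ≤ 1 / 2 := min_le_right _ _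
  have hεδ : ε ≤ 2 * δ := by
    rcases min_choice ε (1 / 2) with h | h <;> rw [hδ, h] <;> linarith
  have hsum : ∑ i, (∑ x, ‖dparC i f x‖ ^ 2) * (1 / (1 + L i)) ^ (1 - δ) ≤ 2 * S := by
    rw [hS, Finset.mul_sum]
    refine Finset.sum_le_sum fun i _ => ?_
    have hLi := hL i
    have e0 := Real.rpow_nonneg hLi (1 - ε)
    have e1 : 1 + L i ^ (1 - ε) ≤ 2 * (1 + L i) ^ (1 - δ) := by
      have b1 : (1 : ℝ) ≤ (1 + L i) ^ (1 - δ) :=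
        Real.one_le_rpow (by linarith) (by linarith)
      have b2 : L i ^ (1 - ε) ≤ (1 + L i) ^ (1 - ε) :=
        Real.rpow_le_rpow hLi (by linarith) (by linarith)
      have b3 : (1 + L i) ^ (1 - ε) ≤ (1 + L i) ^ (1 - δ) :=
        Real.rpow_le_rpow_of_exponent_le (by linarith) (by linarith)
      linarith
    have e2 : (1 / (1 + L i)) ^ (1 - δ) ≤ 2 / (1 + L i ^ (1 - ε)) := by
      rw [Real.div_rpow zero_le_one (by linarith), Real.one_rpow,
        div_le_div_iff₀ (by positivity) (by positivity)]
      linarith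
    calc _ ≤ (∑ x, ‖dparC i f x‖ ^ 2) * (2 / (1 + L i ^ (1 - ε))) := by gcongr
      _ = _ := by ring
  set N := √(∑ x, ‖f x - cubeAvg f‖ ^ 2) with hN
  have hNsq : N ^ 2 = ∑ x, ‖f x - cubeAvg f‖ ^ 2 := Real.sq_sqrt (by positivity)
  have hkey : ∀ l, 0 < l → N ≤ 2 * T * (l / δ + 64 / l * S) := by
    intro l hl
    refine (hE.sqrt_sum_le hT f hL hfL hδ0 (by linarith) hl).trans ?_
    have c1 : 16 / (1 - δ) ≤ 32 := by
      rw [div_le_iff₀ (by linarith)]; linarith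
    have c2 : 0 ≤ ∑ i, (∑ x, ‖dparC i f x‖ ^ 2) * (1 / (1 + L i)) ^ (1 - δ) :=
      Finset.sum_nonneg fun i _ => by
        have := hL i
        positivity
    calc _ ≤ 2 * T * (l / δ + 32 / l * (2 * S)) := by gcongr
      _ = _ := by ring
  rw [← hNsq]
  have hN0 : 0 ≤ N := Real.sqrt_nonneg _
  clear_value N
  rcases hN0.eq_or_lt with h | hpos
  · rw [← h, zero_pow two_ne_zero]; positivity
  have h := hkey (δ * N / (4 * T)) (by positivity)
  have e : 2 * T * (δ * N / (4 * T) / δ + 64 / (δ * N / (4 * T)) * S) =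
      N / 2 + 512 * T ^ 2 * S / (δ * N) := by
    field_simp; ring
  rw [e] at h
  have h2 : N / 2 ≤ 512 * T ^ 2 * S / (δ * N) := by linarith
  rw [le_div_iff₀ (by positivity)] at h2
  rw [div_mul_eq_mul_div, le_div_iff₀ hε]
  have h3 := mul_le_mul_of_nonneg_left hεδ (sq_nonneg N)
  nlinarith

lemma cubeLp_two_sq {n : ℕ} (f : Cube n → E) :
    cubeLp 2 f ^ 2 = (2 ^ n : ℝ)⁻¹ * ∑ x, ‖f x‖ ^ 2 := by
  simp only [cubeLp, Real.rpow_two]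
  rw [← Real.sqrt_eq_rpow, Real.sq_sqrt (by positivity)]

lemma cubeLp_one {n : ℕ} (f : Cube n → E) :
    cubeLp 1 f = (2 ^ n : ℝ)⁻¹ * ∑ x, ‖f x‖ := by
  simp [cubeLp]

lemma cubeLp_nonneg {n : ℕ} (p : ℝ) (f : Cube n → E) : 0 ≤ cubeLp p f :=
  Real.rpow_nonneg (mul_nonneg (by positivity)
    (Finset.sum_nonneg fun _ _ => Real.rpow_nonneg (norm_nonneg _) _)) _

lemma cubeLp_one_le_two {n : ℕ} (f : Cube n → E) : cubeLp 1 f ≤ cubeLp 2 f := by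
  refine le_of_sq_le_sq ?_ (cubeLp_nonneg 2 f)
  rw [cubeLp_two_sq, cubeLp_one]
  have := sq_sum_le_card_mul_sum_sq (s := (univ : Finset (Cube n))) (f := fun x => ‖f x‖)
  simp only [Finset.card_univ, Fintype.card_fun, Fintype.card_bool, Fintype.card_fin] at this
  push_cast at this
  have h2 : (0 : ℝ) < 2 ^ n := by positivity
  rw [mul_pow]
  calc ((2 ^ n : ℝ)⁻¹) ^ 2 * (∑ x, ‖f x‖) ^ 2
      ≤ ((2 ^ n : ℝ)⁻¹) ^ 2 * (2 ^ n * ∑ x, ‖f x‖ ^ 2) := by gcongr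
    _ = _ := by field_simp

lemma log_cubeLp_div_nonneg {n : ℕ} (f : Cube n → E) :
    0 ≤ Real.log (cubeLp 2 f / cubeLp 1 f) := by
  rcases (cubeLp_nonneg 1 f).eq_or_lt with h | h
  · simp [← h]
  · exact Real.log_nonneg ((one_le_div h).2 (cubeLp_one_le_two f))

lemma exp_log_cubeLp_div_sq_mul_le {n : ℕ} (f : Cube n → E) :
    Real.exp (Real.log (cubeLp 2 f / cubeLp 1 f)) ^ 2 * (∑ x, ‖f x‖) ^ 2 ≤
      2 ^ n * ∑ x, ‖f x‖ ^ 2 := by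
  have h2 : (0 : ℝ) < 2 ^ n := by positivity
  have e1 : ∑ x, ‖f x‖ = 2 ^ n * cubeLp 1 f := by rw [cubeLp_one]; field_simp
  have e2 : ∑ x, ‖f x‖ ^ 2 = 2 ^ n * cubeLp 2 f ^ 2 := by rw [cubeLp_two_sq]; field_simp
  rw [e1, e2]
  rcases (cubeLp_nonneg 1 f).eq_or_lt with h | h
  · rw [← h]; simp; positivity
  · rw [Real.exp_log (div_pos (h.trans_le (cubeLp_one_le_two f)) h)]
    exact le_of_eq (by field_simp)

/-- **Vector-valued influence inequality for spaces of Rademacher type 2** (Theorem 1, eq. (6)).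
If `E` is a complex Banach space of Rademacher type 2 with constant `T`, there is
`C = C(T) ∈ (0,∞)` such that for every `ε ∈ (0,1)`, `n ∈ ℕ` and `f : 𝒞_n → E`,
`‖f - E f‖₂² ≤ (C/ε) ∑_i ‖∂_i f‖₂² / (1 + log^{1-ε}(‖∂_i f‖₂/‖∂_i f‖₁))`.
(When `∂_i f ≡ 0` the `i`-th summand below is automatically `0`, matching the convention.) -/
theorem talagrand_type_two_rademacher
    (E : Type*) [NormedAddCommGroup E] [NormedSpace ℂ E] [CompleteSpace E]
    (T : ℝ) (hT : 0 < T)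
    (htype : ∀ (m : ℕ) (v : Fin m → E),
      (2 ^ m : ℝ)⁻¹ * ∑ ε : Cube m, ‖∑ i, sgn' (ε i) • v i‖ ^ 2
        ≤ T ^ 2 * ∑ i, ‖v i‖ ^ 2) :
    ∃ C : ℝ, 0 < C ∧ ∀ ε ∈ Set.Ioo (0 : ℝ) 1, ∀ (n : ℕ) (f : Cube n → E),
      cubeLp 2 (fun x => f x - cubeAvg f) ^ 2
        ≤ (C / ε) * ∑ i : Fin n,
            cubeLp 2 (dparC i f) ^ 2 /
              (1 + Real.log (cubeLp 2 (dparC i f) / cubeLp 1 (dparC i f)) ^ (1 - ε)) := by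
  refine ⟨2048 * T ^ 2, by positivity, fun ε hε n f => ?_⟩
  have hE : HasTypeTwo E T := htype
  have h := hE.sum_sub_cubeAvg_le hT f
    (L := fun i => Real.log (cubeLp 2 (dparC i f) / cubeLp 1 (dparC i f)))
    (fun i => log_cubeLp_div_nonneg _) (fun i => exp_log_cubeLp_div_sq_mul_le _) hε.1 hε.2
  simp only [cubeLp_two_sq, mul_div_assoc, ← Finset.mul_sum]
  rw [mul_left_comm]
  exact mul_le_mul_of_nonneg_left (by simpa only [mul_div_assoc] using h) (by positivity)

end
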